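/- There do not exist sets Y, Z ⊆ ℕ × ℕ such that Y is finite or Z is finite, Prod.fst '' Y = {0}, Prod.snd '' Y = Set.univ, Prod.fst '' Z = Set.univ, and Prod.snd '' Z = {0}. -/

import Mathlib

/-- The witness of failure of weak pullback preservation for the functor
`F X = {(Y, Z) ∈ P X × P X | Y finite or Z finite}` (Section 3.3.4): no
element `(Y, Z)` of `F(ℕ × ℕ)` projects to `α = ({0}, ℕ)` and `β = (ℕ, {0})`. -/
theorem no_pullback_witness :
    ¬ ∃ (Y Z : Set (ℕ × ℕ)), (Y.Finite ∨ Z.Finite) ∧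
      Prod.fst '' Y = {0} ∧ Prod.snd '' Y = Set.univ ∧
      Prod.fst '' Z = Set.univ ∧ Prod.snd '' Z = {0} := by
  rintro ⟨Y, Z, hY | hZ, -, hYsnd, hZfst, -⟩
  · exact Set.infinite_univ (hYsnd ▸ hY.image Prod.snd)
  · exact Set.infinite_univ (hZfst ▸ hZ.image Prod.fst)
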